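/- Wrapping a shift-equivariant map between APS downsampling and APS upsampling preserves shift equivariance (induction step of Proposition 2): fix a real p ≥ 1, let G : (ℤ → ℝ) → (ℤ → ℝ) satisfy G(T_m z) = T_m(G z) for all signals z and integers m, and let x : ℤ → ℝ have both polyphase components in ℓp(ℤ) with ‖poly₀(x)‖_p ≠ ‖poly₁(x)‖_p. Then for every integer k, U^A₂(G(D^A₂(T_k x)), i_{T_k x}) = T_k(U^A₂(G(D^A₂ x), i_x)). -/

import Mathlib

noncomputable section

/-- Shift operator: `(T k x) n = x (n - k)`. -/
def T (k : ℤ) (x : ℤ → ℝ) : ℤ → ℝ := fun n => x (n - k)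

/-- Stride-2 downsampling. -/
def D2 (x : ℤ → ℝ) : ℤ → ℝ := fun n => x (2 * n)

/-- Stride-2 upsampling. -/
def U2 (y : ℤ → ℝ) : ℤ → ℝ := fun n => if (2 : ℤ) ∣ n then y (n / 2) else 0

/-- Even polyphase component. -/
def poly0 (x : ℤ → ℝ) : ℤ → ℝ := fun n => x (2 * n)

/-- Odd polyphase component. -/
def poly1 (x : ℤ → ℝ) : ℤ → ℝ := fun n => x (2 * n + 1)

/-- Membership in ℓp(ℤ): summability of |f|^p. -/
def Memlp (p : ℝ) (f : ℤ → ℝ) : Prop := Summable (fun n => |f n| ^ p)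

/-- The ℓp norm of a signal. -/
def lpNorm (p : ℝ) (f : ℤ → ℝ) : ℝ := (∑' n, |f n| ^ p) ^ (1 / p)

/-- APS index: the index of the polyphase component with larger ℓp norm. -/
def apsIndex (p : ℝ) (x : ℤ → ℝ) : ℤ :=
  if lpNorm p (poly0 x) < lpNorm p (poly1 x) then 1 else 0

/-- Adaptive polyphase downsampling: the polyphase component with larger ℓp norm. -/
def apsD (p : ℝ) (x : ℤ → ℝ) : ℤ → ℝ :=
  if lpNorm p (poly0 x) < lpNorm p (poly1 x) then poly1 x else poly0 x

/-- Adaptive polyphase upsampling with grid index `i`. -/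
def apsU (i : ℤ) (y : ℤ → ℝ) : ℤ → ℝ := T i (U2 y)

theorem T_T (a b : ℤ) (x : ℤ → ℝ) : T a (T b x) = T (a + b) x := by
  funext n
  simp only [T, sub_sub]

theorem U2_T (m : ℤ) (y : ℤ → ℝ) : U2 (T m y) = T (2 * m) (U2 y) := by
  funext n
  have hdvd : (2 : ℤ) ∣ n - 2 * m ↔ (2 : ℤ) ∣ n := by omega
  have hdiv : (n - 2 * m) / 2 = n / 2 - m := by omega
  simp only [U2, T, hdvd, hdiv]

theorem lpNorm_T (p : ℝ) (k : ℤ) (x : ℤ → ℝ) : lpNorm p (T k x) = lpNorm p x :=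
  congrArg (· ^ (1 / p)) ((Equiv.subRight k).tsum_eq fun n => |x n| ^ p)

theorem poly0_T_even (m : ℤ) (x : ℤ → ℝ) : poly0 (T (2 * m) x) = T m (poly0 x) := by
  funext n
  simp only [poly0, T, mul_sub]

theorem poly1_T_even (m : ℤ) (x : ℤ → ℝ) : poly1 (T (2 * m) x) = T m (poly1 x) := by
  funext n
  exact congrArg x (by ring)

theorem poly0_T_odd (m : ℤ) (x : ℤ → ℝ) :
    poly0 (T (2 * m + 1) x) = T (m + 1) (poly1 x) := by
  funext n
  exact congrArg x (by ring)

theorem poly1_T_odd (m : ℤ) (x : ℤ → ℝ) : poly1 (T (2 * m + 1) x) = T m (poly0 x) := by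
  funext n
  exact congrArg x (by ring)

theorem apsU_G_apsD_shift_equivariant (p : ℝ) (hp : 1 ≤ p)
    (G : (ℤ → ℝ) → (ℤ → ℝ)) (hG : ∀ (z : ℤ → ℝ) (m : ℤ), G (T m z) = T m (G z))
    (x : ℤ → ℝ)
    (h0 : Memlp p (poly0 x)) (h1 : Memlp p (poly1 x))
    (hne : lpNorm p (poly0 x) ≠ lpNorm p (poly1 x)) :
    ∀ k : ℤ,
      apsU (apsIndex p (T k x)) (G (apsD p (T k x))) =
        T k (apsU (apsIndex p x) (G (apsD p x))) := by
  intro k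
  obtain ⟨m, rfl | rfl⟩ := Int.even_or_odd' k
  · simp only [apsU, apsIndex, apsD, poly0_T_even, poly1_T_even, lpNorm_T]
    split_ifs <;> rw [hG, U2_T, T_T, T_T, add_comm]
  · simp only [apsU, apsIndex, apsD, poly0_T_odd, poly1_T_odd, lpNorm_T]
    rcases hne.lt_or_gt with h | h
    · rw [if_neg h.not_gt, if_neg h.not_gt, if_pos h, if_pos h, hG, U2_T, T_T, T_T]
      congr 1
      ring
    · rw [if_pos h, if_pos h, if_neg h.not_gt, if_neg h.not_gt, hG, U2_T, T_T, T_T]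
      congr 1
      ring
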